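/- arXiv:2110.02786 — 2 statements merged into one kernel-verified Lean document; each statement's English description precedes it below -/
import Mathlib

section
/- Define by recursion on n ≥ 1: an ordinal α is 1-deep iff there exists a normal measure on α, and α is (n+1)-deep iff the set {β < α : β is n-deep} belongs to some normal measure on α. Then for every n ≥ 1 and every ordinal α: α is n-deep if and only if there exists a ◁-chain of length n of normal measures on α. (In the normal-measure semantics, ◇ⁿ⊤ is true at α iff α is a measurable cardinal of Mitchell order at least n.) -/
/-- A normal measure on an ordinal `η`: an ultrafilter on the set of ordinals below `η`
(coded as a family of subsets of `Set.Iio η`) which is nonprincipal, `η`-complete and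
normal (closed under diagonal intersections). -/
structure IsNormalMeasure (η : Ordinal) (U : Set (Set Ordinal)) : Prop where
  subset_iio : ∀ X ∈ U, X ⊆ Set.Iio η
  univ_mem : Set.Iio η ∈ U
  superset_mem : ∀ X ∈ U, ∀ Y ⊆ Set.Iio η, X ⊆ Y → Y ∈ U
  inter_mem : ∀ X ∈ U, ∀ Y ∈ U, X ∩ Y ∈ U
  empty_not_mem : ∅ ∉ U
  ultra : ∀ X ⊆ Set.Iio η, X ∈ U ∨ (Set.Iio η \ X) ∈ U
  nonprincipal : ∀ α : Ordinal, {α} ∉ U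
  complete : ∀ θ < η, ∀ A : Ordinal → Set Ordinal, (∀ ξ < θ, A ξ ∈ U) →
      (Set.Iio η ∩ ⋂ ξ ∈ Set.Iio θ, A ξ) ∈ U
  normal : ∀ A : Ordinal → Set Ordinal, (∀ ξ < η, A ξ ∈ U) →
      {α | α < η ∧ ∀ ξ < α, α ∈ A ξ} ∈ U

/-- `MSet η` is the collection of all subsets of `η` belonging to every normal measure on `η`. -/
def MSet (η : Ordinal) : Set (Set Ordinal) :=
  {X | X ⊆ Set.Iio η ∧ ∀ U, IsNormalMeasure η U → X ∈ U}

/-- `g` witnesses `W ◁ U` (combinatorial Mitchell order) on `η`. -/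
def MitchellWitness (η : Ordinal) (g : Ordinal → Set (Set Ordinal))
    (W U : Set (Set Ordinal)) : Prop :=
  {ν | ν < η ∧ IsNormalMeasure ν (g ν)} ∈ U ∧
  W = {X | X ⊆ Set.Iio η ∧ {ν | ν < η ∧ X ∩ Set.Iio ν ∈ g ν} ∈ U}

/-- The combinatorial Mitchell order. -/
def MitchellLt (η : Ordinal) (W U : Set (Set Ordinal)) : Prop :=
  ∃ g, MitchellWitness η g W U

/-- A ◁-chain of length `n` of normal measures on `η`: measures `W 1, …, W n` with
`W i ◁ W (i+1)` for `1 ≤ i < n`. Every ordinal has a chain of length `0`. -/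
def HasMitchellChain (η : Ordinal) (n : ℕ) : Prop :=
  ∃ W : ℕ → Set (Set Ordinal),
    (∀ i, 1 ≤ i → i ≤ n → IsNormalMeasure η (W i)) ∧
    (∀ i, 1 ≤ i → i + 1 ≤ n → MitchellLt η (W i) (W (i + 1)))

/-- `Deep n α` (for `n ≥ 1`): `α` is `1`-deep iff it carries a normal measure, and
`(n+1)`-deep iff the set of `n`-deep ordinals below `α` belongs to some normal measure
on `α`. (`Deep 0` is a dummy value.) -/
def Deep : ℕ → Ordinal → Prop
  | 0, _ => True
  | 1, α => ∃ U, IsNormalMeasure α U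
  | (n + 2), α => ∃ U, IsNormalMeasure α U ∧ {β | β < α ∧ Deep (n + 1) β} ∈ U

theorem deep_succ_iff (n : ℕ) (α : Ordinal) :
    Deep (n + 1) α ↔ ∃ U, IsNormalMeasure α U ∧ {β | β < α ∧ Deep n β} ∈ U := by
  cases n with
  | zero =>
    simp only [Deep]
    constructor
    · rintro ⟨U, hU⟩
      refine ⟨U, hU, ?_⟩
      have h := hU.univ_mem
      have e : {β : Ordinal | β < α ∧ True} = Set.Iio α := by ext; simp
      rw [e]; exact h
    · rintro ⟨U, hU, _⟩
      exact ⟨U, hU⟩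
  | succ n => simp only [Deep]

theorem IsNormalMeasure.gt_mem {η : Ordinal} {U : Set (Set Ordinal)} (hU : IsNormalMeasure η U)
    (θ : Ordinal) (hθ : θ < η) : {ν | ν < η ∧ θ < ν} ∈ U := by
  have key : ∀ ξ : Ordinal, Set.Iio η \ {ξ} ∈ U := by
    intro ξ
    by_cases h : ξ < η
    · rcases hU.ultra {ξ} (by simpa using h) with h1 | h1
      · exact absurd h1 (hU.nonprincipal ξ)
      · exact h1
    · refine hU.superset_mem _ hU.univ_mem _ Set.diff_subset ?_
      intro x hx
      refine ⟨hx, ?_⟩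
      rintro rfl
      exact h hx
  have h1 := hU.complete θ hθ (fun ξ => Set.Iio η \ {ξ}) (fun ξ _ => key ξ)
  refine hU.superset_mem _ (hU.inter_mem _ h1 _ (key θ)) _ (fun x hx => hx.1) ?_
  rintro x ⟨⟨hx, hx2⟩, -, hx3⟩
  refine ⟨hx, ?_⟩
  by_contra hlt
  rcases lt_or_eq_of_le (not_lt.1 hlt) with h | h
  · have := Set.mem_iInter₂.1 hx2 x h
    exact this.2 rfl
  · exact hx3 h

theorem limit_normal {η : Ordinal} {U : Set (Set Ordinal)} (hU : IsNormalMeasure η U)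
    (g : Ordinal → Set (Set Ordinal)) (hg : {ν | ν < η ∧ IsNormalMeasure ν (g ν)} ∈ U) :
    IsNormalMeasure η {X | X ⊆ Set.Iio η ∧ {ν | ν < η ∧ X ∩ Set.Iio ν ∈ g ν} ∈ U} where
  subset_iio X hX := hX.1
  univ_mem := by
    refine ⟨subset_rfl, hU.superset_mem _ hg _ (fun x hx => hx.1) ?_⟩
    rintro ν ⟨hν, h⟩
    refine ⟨hν, ?_⟩
    rw [Set.inter_eq_right.2 (Set.Iio_subset_Iio hν.le)]
    exact h.univ_mem
  superset_mem := by
    rintro X ⟨hX, hX2⟩ Y hY hXY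
    refine ⟨hY, hU.superset_mem _ (hU.inter_mem _ hg _ hX2) _ (fun x hx => hx.1) ?_⟩
    rintro ν ⟨⟨hν, h⟩, -, h2⟩
    exact ⟨hν, h.superset_mem _ h2 _ Set.inter_subset_right (Set.inter_subset_inter_left _ hXY)⟩
  inter_mem := by
    rintro X ⟨hX, hX2⟩ Y ⟨hY, hY2⟩
    refine ⟨fun x hx => hX hx.1, hU.superset_mem _
      (hU.inter_mem _ hg _ (hU.inter_mem _ hX2 _ hY2)) _ (fun x hx => hx.1) ?_⟩
    rintro ν ⟨⟨hν, h⟩, ⟨-, h2⟩, -, h3⟩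
    refine ⟨hν, ?_⟩
    rw [Set.inter_inter_distrib_right]
    exact h.inter_mem _ h2 _ h3
  empty_not_mem := by
    rintro ⟨-, h⟩
    have h2 := hU.inter_mem _ hg _ h
    refine hU.empty_not_mem ?_
    convert h2
    symm
    rw [Set.eq_empty_iff_forall_notMem]
    rintro ν ⟨⟨hν, h⟩, -, h2⟩
    rw [Set.empty_inter] at h2
    exact h.empty_not_mem h2
  ultra := by
    intro X hX
    rcases hU.ultra {ν | ν < η ∧ X ∩ Set.Iio ν ∈ g ν} (fun x hx => hx.1) with h | h
    · exact Or.inl ⟨hX, h⟩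
    · refine Or.inr ⟨Set.diff_subset, hU.superset_mem _ (hU.inter_mem _ hg _ h) _
        (fun x hx => hx.1) ?_⟩
      rintro ν ⟨⟨hν, h⟩, -, h2⟩
      refine ⟨hν, ?_⟩
      rcases h.ultra (X ∩ Set.Iio ν) Set.inter_subset_right with h3 | h3
      · exact absurd ⟨hν, h3⟩ h2
      · refine h.superset_mem _ h3 _ Set.inter_subset_right ?_
        rintro x ⟨hx, hx2⟩
        exact ⟨⟨lt_trans hx hν, fun h => hx2 ⟨h, hx⟩⟩, hx⟩
  nonprincipal := by
    rintro a ⟨-, h⟩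
    have h2 := hU.inter_mem _ hg _ h
    refine hU.empty_not_mem ?_
    convert h2
    symm
    rw [Set.eq_empty_iff_forall_notMem]
    rintro ν ⟨⟨hν, h⟩, -, h2⟩
    by_cases ha : a < ν
    · rw [Set.inter_eq_left.2 (by simpa using ha)] at h2
      exact h.nonprincipal _ h2
    · refine h.empty_not_mem ?_
      convert h2
      symm
      rw [Set.eq_empty_iff_forall_notMem]
      rintro x ⟨rfl, hx⟩
      exact ha hx
  complete := by
    intro θ hθ A hA
    refine ⟨Set.inter_subset_left, ?_⟩
    have h1 := hU.complete θ hθ (fun ξ => {ν | ν < η ∧ A ξ ∩ Set.Iio ν ∈ g ν})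
      (fun ξ hξ => (hA ξ hξ).2)
    refine hU.superset_mem _ (hU.inter_mem _ hg _ (hU.inter_mem _ (hU.gt_mem θ hθ) _ h1)) _
      (fun x hx => hx.1) ?_
    rintro ν ⟨⟨hν, h⟩, ⟨-, hθν⟩, -, h2⟩
    refine ⟨hν, ?_⟩
    have h3 := h.complete θ hθν (fun ξ => A ξ ∩ Set.Iio ν)
      (fun ξ hξ => (Set.mem_iInter₂.1 h2 ξ hξ).2)
    refine h.superset_mem _ h3 _ Set.inter_subset_right ?_
    rintro x ⟨hx, hx2⟩
    refine ⟨⟨lt_trans hx hν, Set.mem_iInter₂.2 fun ξ hξ => ?_⟩, hx⟩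
    exact (Set.mem_iInter₂.1 hx2 ξ hξ).1
  normal := by
    intro A hA
    refine ⟨fun x hx => hx.1, ?_⟩
    have h1 := hU.normal (fun ξ => {ν | ν < η ∧ A ξ ∩ Set.Iio ν ∈ g ν})
      (fun ξ hξ => (hA ξ hξ).2)
    refine hU.superset_mem _ (hU.inter_mem _ hg _ h1) _ (fun x hx => hx.1) ?_
    rintro ν ⟨⟨hν, h⟩, -, h2⟩
    refine ⟨hν, ?_⟩
    have h3 := h.normal (fun ξ => A ξ ∩ Set.Iio ν) (fun ξ hξ => (h2 ξ hξ).2)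
    refine h.superset_mem _ h3 _ Set.inter_subset_right ?_
    rintro x ⟨hx, hx2⟩
    exact ⟨⟨lt_trans hx hν, fun ξ hξ => (hx2 ξ hξ).1⟩, hx⟩

theorem inter_deep {η ν : Ordinal} (hν : ν < η) (n : ℕ) :
    {β | β < η ∧ Deep n β} ∩ Set.Iio ν = {β | β < ν ∧ Deep n β} := by
  ext x
  constructor
  · rintro ⟨⟨-, h⟩, h2⟩
    exact ⟨h2, h⟩
  · rintro ⟨h, h2⟩
    exact ⟨⟨h.trans hν, h2⟩, h⟩

theorem step_up {η : Ordinal} {W U : Set (Set Ordinal)} (hU : IsNormalMeasure η U)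
    (h : MitchellLt η W U) (n : ℕ) (hW : {β | β < η ∧ Deep n β} ∈ W) :
    {β | β < η ∧ Deep (n + 1) β} ∈ U := by
  obtain ⟨g, hg, rfl⟩ := h
  refine hU.superset_mem _ (hU.inter_mem _ hg _ hW.2) _ (fun x hx => hx.1) ?_
  rintro ν ⟨⟨hν, h⟩, -, h2⟩
  rw [inter_deep hν] at h2
  exact ⟨hν, (deep_succ_iff n ν).2 ⟨g ν, h, h2⟩⟩

theorem step_down {η : Ordinal} {U : Set (Set Ordinal)} (hU : IsNormalMeasure η U) (n : ℕ)
    (h : {β | β < η ∧ Deep (n + 1) β} ∈ U) :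
    ∃ W, IsNormalMeasure η W ∧ MitchellLt η W U ∧ {β | β < η ∧ Deep n β} ∈ W := by
  have h0 : ∀ β : Ordinal, ∃ V, Deep (n + 1) β →
      IsNormalMeasure β V ∧ {γ | γ < β ∧ Deep n γ} ∈ V := by
    intro β
    by_cases hβ : Deep (n + 1) β
    · obtain ⟨V, hV⟩ := (deep_succ_iff n β).1 hβ
      exact ⟨V, fun _ => hV⟩
    · exact ⟨∅, fun h => absurd h hβ⟩
  choose g hg using h0
  have hg1 : {ν | ν < η ∧ IsNormalMeasure ν (g ν)} ∈ U :=
    hU.superset_mem _ h _ (fun x hx => hx.1) (fun ν hν => ⟨hν.1, (hg ν hν.2).1⟩)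
  refine ⟨_, limit_normal hU g hg1, ⟨g, hg1, rfl⟩, fun x hx => hx.1, ?_⟩
  refine hU.superset_mem _ h _ (fun x hx => hx.1) ?_
  rintro ν ⟨hν, h2⟩
  refine ⟨hν, ?_⟩
  rw [inter_deep hν]
  exact (hg ν h2).2

theorem chain_of_deep {η : Ordinal} (n : ℕ) : ∀ U, IsNormalMeasure η U →
    {β | β < η ∧ Deep n β} ∈ U → ∃ W : ℕ → Set (Set Ordinal), W (n + 1) = U ∧
    (∀ i, 1 ≤ i → i ≤ n + 1 → IsNormalMeasure η (W i)) ∧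
    (∀ i, 1 ≤ i → i + 1 ≤ n + 1 → MitchellLt η (W i) (W (i + 1))) := by
  induction n with
  | zero =>
    intro U hU _
    exact ⟨fun _ => U, rfl, fun _ _ _ => hU, fun i h1 h2 => by omega⟩
  | succ n ih =>
    intro U hU h
    obtain ⟨V, hV, hVU, hd⟩ := step_down hU n h
    obtain ⟨W, hW, hW1, hW2⟩ := ih V hV hd
    refine ⟨fun i => if i = n + 2 then U else W i, by simp, ?_, ?_⟩
    · intro i h1 h2
      by_cases hi : i = n + 2
      · simpa [hi] using hU
      · simpa [hi] using hW1 i h1 (by omega)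
    · intro i h1 h2
      by_cases hi : i = n + 1
      · subst hi
        simpa [hW] using hVU
      · have e1 : i ≠ n + 2 := by omega
        simpa [hi, e1] using hW2 i h1 (by omega)

/-- For `n ≥ 1`: `α` is `n`-deep iff there is a ◁-chain of normal measures on `α` of
length `n`. -/
theorem deep_iff_mitchell_chain (n : ℕ) (hn : 1 ≤ n) (α : Ordinal) :
    Deep n α ↔ HasMitchellChain α n := by
  obtain ⟨n, rfl⟩ : ∃ m, n = m + 1 := ⟨n - 1, by omega⟩
  constructor
  · intro h
    obtain ⟨U, hU, h⟩ := (deep_succ_iff n α).1 h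
    obtain ⟨W, -, hW⟩ := chain_of_deep n U hU h
    exact ⟨W, hW⟩
  · rintro ⟨W, hW, hlt⟩
    have key : ∀ k, k ≤ n → {β | β < α ∧ Deep k β} ∈ W (k + 1) := by
      intro k
      induction k with
      | zero =>
        intro _
        have e : {β : Ordinal | β < α ∧ Deep 0 β} = Set.Iio α := by ext; simp [Deep]
        rw [e]
        exact (hW 1 le_rfl (by omega)).univ_mem
      | succ k ih =>
        intro hk
        exact step_up (hW _ (by omega) (by omega)) (hlt (k + 1) (by omega) (by omega)) k
          (ih (by omega))
    exact (deep_succ_iff n α).2 ⟨_, hW (n + 1) (by omega) le_rfl, key n le_rfl⟩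
end

section
/- (Soundness of GL for the normal-measure filter sequence, Blass.) If GL ⊢ φ, then φ is M⃗-valid: for every valuation ν and every ordinal α, α ∈ ν(φ). -/
/-- Modal formulas: propositional variables, ⊥, implication, and □. -/
inductive ModalFormula : Type
  | var : ℕ → ModalFormula
  | bot : ModalFormula
  | imp : ModalFormula → ModalFormula → ModalFormula
  | box : ModalFormula → ModalFormula

/-- `φ` is a substitution instance of a propositional tautology: every Boolean
valuation of formulas commuting with `⊥` and `→` makes `φ` true. -/
def IsTautInstance (φ : ModalFormula) : Prop :=
  ∀ v : ModalFormula → Bool,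
    v ModalFormula.bot = false →
    (∀ ψ χ, v (ModalFormula.imp ψ χ) = (!(v ψ) || v χ)) →
    v φ = true

/-- The provability logic GL: tautology instances, K, Löb, modus ponens, necessitation. -/
inductive GLProof : ModalFormula → Prop
  | taut {φ} : IsTautInstance φ → GLProof φ
  | axK (φ ψ : ModalFormula) :
      GLProof ((ModalFormula.box (ModalFormula.imp φ ψ)).imp
        ((ModalFormula.box φ).imp (ModalFormula.box ψ)))
  | axLob (φ : ModalFormula) :
      GLProof ((ModalFormula.box ((ModalFormula.box φ).imp φ)).imp (ModalFormula.box φ))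
  | mp {φ ψ} : GLProof (ModalFormula.imp φ ψ) → GLProof φ → GLProof ψ
  | nec {φ} : GLProof φ → GLProof (ModalFormula.box φ)

/-- The normal-measure valuation of a modal formula: `ν(□φ) = {α : ν(φ) ∩ α ∈ M_α}`. -/
def mval (v : ℕ → Set Ordinal) : ModalFormula → Set Ordinal
  | ModalFormula.var n => v n
  | ModalFormula.bot => ∅
  | ModalFormula.imp φ ψ => (mval v φ)ᶜ ∪ mval v ψ
  | ModalFormula.box φ => {α | mval v φ ∩ Set.Iio α ∈ MSet α}

/-- The ultrafilter limit of normal measures `g ν` along a normal measure `U`. -/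
theorem IsNormalMeasure.limit {η : Ordinal} {U : Set (Set Ordinal)} (hU : IsNormalMeasure η U)
    (g : Ordinal → Set (Set Ordinal)) (S : Set Ordinal) (hS : S ∈ U)
    (hg : ∀ ν ∈ S, IsNormalMeasure ν (g ν)) :
    IsNormalMeasure η {X | X ⊆ Set.Iio η ∧ {ν | ν < η ∧ X ∩ Set.Iio ν ∈ g ν} ∈ U} := by
  have up : ∀ T ∈ U, ∀ X : Set Ordinal, (∀ ν ∈ T, ν ∈ S → X ∩ Set.Iio ν ∈ g ν) →
      {ν | ν < η ∧ X ∩ Set.Iio ν ∈ g ν} ∈ U := by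
    intro T hT X h
    refine hU.superset_mem _ (hU.inter_mem _ hT _ hS) _ (fun ν hν => hν.1) ?_
    rintro ν ⟨h1, h2⟩
    exact ⟨hU.subset_iio _ hS h2, h ν h1 h2⟩
  have disj : ∀ T ∈ U, (∀ ν ∈ T, ν ∉ S) → False := by
    intro T hT h
    apply hU.empty_not_mem
    have := hU.inter_mem _ hT _ hS
    have e : T ∩ S = ∅ := by
      ext ν
      simp only [Set.mem_inter_iff, Set.mem_empty_iff_false, iff_false]
      rintro ⟨h1, h2⟩
      exact h ν h1 h2
    rwa [e] at this
  refine ⟨fun X hX => hX.1, ?_, ?_, ?_, ?_, ?_, ?_, ?_, ?_⟩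
  · refine ⟨subset_rfl, up S hS _ fun ν hν _ => ?_⟩
    refine (hg ν hν).superset_mem _ (hg ν hν).univ_mem _ Set.inter_subset_right ?_
    intro x hx
    exact ⟨Set.mem_Iio.2 (lt_trans (Set.mem_Iio.1 hx) (Set.mem_Iio.1 (hU.subset_iio _ hS hν))), hx⟩
  · rintro X ⟨_, hX⟩ Y hY hXY
    refine ⟨hY, up _ hX _ fun ν hν hs => ?_⟩
    exact (hg ν hs).superset_mem _ hν.2 _ Set.inter_subset_right
      (Set.inter_subset_inter_left _ hXY)
  · rintro X ⟨hX1, hX⟩ Y ⟨_, hY⟩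
    refine ⟨fun x hx => hX1 hx.1, up _ (hU.inter_mem _ hX _ hY) _ fun ν hν hs => ?_⟩
    exact (hg ν hs).superset_mem _ ((hg ν hs).inter_mem _ hν.1.2 _ hν.2.2) _
      Set.inter_subset_right (fun x hx => ⟨⟨hx.1.1, hx.2.1⟩, hx.1.2⟩)
  · rintro ⟨_, h⟩
    refine disj _ h fun ν hν hs => (hg ν hs).empty_not_mem ?_
    simpa using hν.2
  · intro X hX
    rcases hU.ultra {ν | ν < η ∧ X ∩ Set.Iio ν ∈ g ν} (fun ν hν => hν.1) with h | h
    · exact Or.inl ⟨hX, h⟩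
    · refine Or.inr ⟨Set.sdiff_subset, up _ h _ fun ν hν hs => ?_⟩
      rcases (hg ν hs).ultra (X ∩ Set.Iio ν) Set.inter_subset_right with h' | h'
      · exact absurd ⟨hν.1, h'⟩ hν.2
      · refine (hg ν hs).superset_mem _ h' _ Set.inter_subset_right ?_
        rintro x ⟨hx, hx'⟩
        exact ⟨⟨Set.mem_Iio.2 (lt_trans (Set.mem_Iio.1 hx) hν.1), fun h => hx' ⟨h, hx⟩⟩, hx⟩
  · rintro α ⟨_, h⟩
    refine disj _ h fun ν hν hs => (hg ν hs).nonprincipal α ?_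
    have h2 := hν.2
    by_cases hα : α < ν
    · exact (hg ν hs).superset_mem _ h2 _ (by simpa using hα) Set.inter_subset_left
    · exfalso
      apply (hg ν hs).empty_not_mem
      have e : ({α} : Set Ordinal) ∩ Set.Iio ν = ∅ := by
        ext x
        simp only [Set.mem_inter_iff, Set.mem_singleton_iff, Set.mem_Iio,
          Set.mem_empty_iff_false, iff_false]
        rintro ⟨rfl, hlt⟩
        exact hα hlt
      rwa [e] at h2
  · intro θ hθ A hA
    refine ⟨Set.inter_subset_left, ?_⟩
    have cos : ∀ ξ, ξ < η → Set.Iio η \ {ξ} ∈ U := fun ξ hξ =>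
      (hU.ultra {ξ} (by simpa using hξ)).resolve_left (hU.nonprincipal ξ)
    have h1 := hU.complete θ hθ (fun ξ => Set.Iio η \ {ξ}) (fun ξ hξ => cos ξ (hξ.trans hθ))
    have h2 := hU.complete θ hθ (fun ξ => {ν | ν < η ∧ A ξ ∩ Set.Iio ν ∈ g ν})
      (fun ξ hξ => (hA ξ hξ).2)
    refine up _ (hU.inter_mem _ (hU.inter_mem _ h1 _ (cos θ hθ)) _ h2) _ fun ν hν hs => ?_
    obtain ⟨⟨⟨hνη, ha⟩, hb⟩, -, hc⟩ := hν
    simp only [Set.mem_iInter, Set.mem_Iio] at ha hc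
    have hθν : θ < ν := by
      rcases lt_trichotomy θ ν with h | h | h
      · exact h
      · exact absurd h.symm hb.2
      · exact absurd rfl (ha ν h).2
    have := (hg ν hs).complete θ hθν (fun ξ => A ξ ∩ Set.Iio ν) (fun ξ hξ => (hc ξ hξ).2)
    refine (hg ν hs).superset_mem _ this _ Set.inter_subset_right ?_
    rintro x ⟨hx, hx'⟩
    simp only [Set.mem_iInter] at hx'
    refine ⟨⟨Set.mem_Iio.2 (lt_trans (Set.mem_Iio.1 hx) (Set.mem_Iio.1 hνη)), ?_⟩, hx⟩
    simp only [Set.mem_iInter]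
    exact fun ξ hξ => (hx' ξ hξ).1
  · intro A hA
    refine ⟨fun x hx => hx.1, ?_⟩
    have h := hU.normal (fun ξ => {ν | ν < η ∧ A ξ ∩ Set.Iio ν ∈ g ν}) (fun ξ hξ => (hA ξ hξ).2)
    refine up _ h _ fun ν hν hs => ?_
    have := (hg ν hs).normal (fun ξ => A ξ ∩ Set.Iio ν) (fun ξ hξ => (hν.2 ξ hξ).2)
    refine (hg ν hs).superset_mem _ this _ Set.inter_subset_right ?_
    rintro x ⟨hx, hx'⟩
    exact ⟨⟨hx.trans hν.1, fun ξ hξ => (hx' ξ hξ).1⟩, hx⟩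

/-- If some normal measure on `α` contains `A`, then some normal measure on `α` concentrates
on those points of `A` at which `A` is null for all normal measures. -/
theorem exists_minimal_measure (A : Set Ordinal) (α : Ordinal) :
    (∃ U, IsNormalMeasure α U ∧ A ∩ Set.Iio α ∈ U) →
    ∃ U, IsNormalMeasure α U ∧
      (A ∩ {ν | ¬ ∃ V, IsNormalMeasure ν V ∧ A ∩ Set.Iio ν ∈ V}) ∩ Set.Iio α ∈ U := by
  induction α using WellFoundedLT.induction with
  | ind α ih =>
  rintro ⟨U, hU, hA⟩
  set B : Set Ordinal := A ∩ {ν | ¬ ∃ V, IsNormalMeasure ν V ∧ A ∩ Set.Iio ν ∈ V} with hB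
  rcases hU.ultra (B ∩ Set.Iio α) Set.inter_subset_right with h | h
  · exact ⟨U, hU, h⟩
  have hS := hU.inter_mem _ hA _ h
  set S := (A ∩ Set.Iio α) ∩ (Set.Iio α \ (B ∩ Set.Iio α)) with hSdef
  have key : ∀ ν, ∃ V, ν ∈ S → IsNormalMeasure ν V ∧ B ∩ Set.Iio ν ∈ V := by
    intro ν
    by_cases hν : ν ∈ S
    · obtain ⟨⟨h1, h2⟩, -, h3⟩ := hν
      have : ∃ V, IsNormalMeasure ν V ∧ A ∩ Set.Iio ν ∈ V := by
        by_contra hc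
        exact h3 ⟨⟨h1, hc⟩, h2⟩
      obtain ⟨V, hV⟩ := ih ν h2 this
      exact ⟨V, fun _ => hV⟩
    · exact ⟨∅, fun h => absurd h hν⟩
  choose g hg using key
  refine ⟨_, hU.limit g S hS (fun ν hν => (hg ν hν).1), Set.inter_subset_right, ?_⟩
  refine hU.superset_mem _ hS _ (fun ν hν => hν.1) ?_
  intro ν hν
  have hlt : ν < α := hν.1.2
  refine ⟨hlt, ?_⟩
  refine (hg ν hν).1.superset_mem _ (hg ν hν).2 _ Set.inter_subset_right ?_
  rintro x ⟨hx, hx'⟩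
  exact ⟨⟨hx, Set.mem_Iio.2 (lt_trans (Set.mem_Iio.1 hx') hlt)⟩, hx'⟩

theorem mem_mval_imp (v : ℕ → Set Ordinal) (φ ψ : ModalFormula) (α : Ordinal) :
    α ∈ mval v (φ.imp ψ) ↔ (α ∈ mval v φ → α ∈ mval v ψ) := by
  simp only [mval, Set.mem_union, Set.mem_compl_iff]
  tauto

theorem mem_mval_box (v : ℕ → Set Ordinal) (φ : ModalFormula) (α : Ordinal) :
    α ∈ mval v φ.box ↔ ∀ U, IsNormalMeasure α U → mval v φ ∩ Set.Iio α ∈ U := by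
  simp [mval, MSet]

/-- Soundness of GL for the normal-measure filter sequence (Blass): every GL-provable
formula is `M⃗`-valid. -/
theorem GL_sound_normal_measures (φ : ModalFormula) (h : GLProof φ) :
    ∀ (v : ℕ → Set Ordinal) (α : Ordinal), α ∈ mval v φ := by
  intro v
  induction h with
  | taut ht =>
    intro α
    classical
    have := ht (fun ψ => decide (α ∈ mval v ψ)) (by simp [mval]) (by
      intro ψ χ
      by_cases h1 : α ∈ mval v ψ <;> by_cases h2 : α ∈ mval v χ <;> simp [mem_mval_imp, h1, h2])
    simpa using this
  | axK φ ψ =>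
    intro α
    simp only [mem_mval_imp, mem_mval_box]
    intro h1 h2 U hU
    refine hU.superset_mem _ (hU.inter_mem _ (h1 U hU) _ (h2 U hU)) _ Set.inter_subset_right ?_
    rintro x ⟨⟨ha, hx⟩, hb, -⟩
    exact ⟨(mem_mval_imp v φ ψ x).1 ha hb, hx⟩
  | axLob φ =>
    intro α
    rw [mem_mval_imp, mem_mval_box, mem_mval_box]
    intro h U hU
    by_contra hc
    have hc' := (hU.ultra _ Set.inter_subset_right).resolve_left hc
    obtain ⟨W, hW, hm⟩ := exists_minimal_measure (mval v φ)ᶜ α ⟨U, hU, by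
      refine hU.superset_mem _ hc' _ Set.inter_subset_right ?_
      rintro x ⟨hx, hx'⟩
      exact ⟨fun h => hx' ⟨h, hx⟩, hx⟩⟩
    apply hW.empty_not_mem
    have hi := hW.inter_mem _ (h W hW) _ hm
    convert hi using 1
    symm
    rw [Set.eq_empty_iff_forall_notMem]
    rintro x ⟨⟨ha, -⟩, ⟨hb, hn⟩, -⟩
    rw [mem_mval_imp, mem_mval_box] at ha
    refine hb (ha fun V hV => ?_)
    by_contra hcV
    refine hn ⟨V, hV, ?_⟩
    refine hV.superset_mem _ ((hV.ultra _ Set.inter_subset_right).resolve_left hcV) _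
      Set.inter_subset_right ?_
    rintro y ⟨hy, hy'⟩
    exact ⟨fun h => hy' ⟨h, hy⟩, hy⟩
  | mp _ _ ih1 ih2 =>
    intro α
    exact (mem_mval_imp v _ _ α).1 (ih1 α) (ih2 α)
  | nec _ ih =>
    intro α
    rw [mem_mval_box]
    intro U hU
    exact hU.superset_mem _ hU.univ_mem _ Set.inter_subset_right (fun x hx => ⟨ih x, hx⟩)
end
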